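/- The function Φ̃ : ℝ^{3×3} → ℝ defined by Φ̃(X) = tr[(dev₃ X)²] is not convex. In particular there exists a real 3×3 matrix H with tr(H) = 0 and tr(H²) = −2 < 0, along which the second directional derivative of Φ̃ is negative. -/

import Mathlib

open Matrix

noncomputable section

/-- 3×3 real matrices. -/
abbrev M3 := Matrix (Fin 3) (Fin 3) ℝ

/-- Deviatoric part: dev₃ X = X − (1/3) tr(X) 𝟙. -/
def dev3 (X : M3) : M3 := X - (X.trace / 3) • (1 : M3)

/-- The infinitesimal rotation in the plane of the first two axes. -/
def planeRotation : M3 := !![0, 1, 0; -1, 0, 0; 0, 0, 0]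

lemma trace_planeRotation : planeRotation.trace = 0 := by
  simp [planeRotation, Matrix.trace, Fin.sum_univ_three]

lemma trace_planeRotation_mul_self : (planeRotation * planeRotation).trace = -2 := by
  simp [planeRotation, Matrix.trace, Fin.sum_univ_three]
  norm_num

lemma dev3_of_trace_eq_zero {X : M3} (hX : X.trace = 0) : dev3 X = X := by
  simp [dev3, hX]

/-- The function Φ̃(X) = tr[(dev₃ X)²] is not convex; in particular there is a trace-free
matrix `H` with tr(H²) = −2 < 0 (the second directional derivative of Φ̃ along `H`). -/
theorem stmt9 :
    ¬ ConvexOn ℝ (Set.univ : Set M3) (fun X : M3 => (dev3 X * dev3 X).trace) ∧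
    ∃ H : M3, H.trace = 0 ∧ (H * H).trace = -2 := by
  refine ⟨fun h => ?_, planeRotation, trace_planeRotation, trace_planeRotation_mul_self⟩
  have key := h.2 (Set.mem_univ planeRotation) (Set.mem_univ (-planeRotation))
    (by norm_num : (0 : ℝ) ≤ 1 / 2) (by norm_num : (0 : ℝ) ≤ 1 / 2) (by norm_num)
  have hneg : (-planeRotation).trace = 0 := by rw [Matrix.trace_neg, trace_planeRotation, neg_zero]
  have hzero : (1 / 2 : ℝ) • planeRotation + (1 / 2 : ℝ) • -planeRotation = 0 := by
    rw [smul_neg, add_neg_cancel]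
  simp only [hzero, dev3_of_trace_eq_zero hneg, dev3_of_trace_eq_zero trace_planeRotation,
    dev3_of_trace_eq_zero (Matrix.trace_zero (Fin 3) ℝ), neg_mul_neg,
    trace_planeRotation_mul_self, mul_zero, Matrix.trace_zero, smul_eq_mul] at key
  norm_num at key
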